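/- The relative robustness between density operators equals the optimal value of the convex program: R⁺(ρ, σ) = max{ tr(ρX) − 1 : X ≥ 0, tr(σX) ≤ 1 }, whenever the support of ρ is contained in the support of σ. -/

import Mathlib

open Matrix BigOperators ComplexOrder

/-- A density operator: positive semidefinite with unit trace. -/
def IsDensity {d : ℕ} (ρ : Matrix (Fin d) (Fin d) ℂ) : Prop :=
  ρ.PosSemidef ∧ ρ.trace = 1

open scoped MatrixOrder in
theorem Matrix.PosSemidef.exists_eq_conjTranspose_mul_self {n : Type*} [Fintype n] [DecidableEq n]
    {A : Matrix n n ℂ} (hA : A.PosSemidef) : ∃ B : Matrix n n ℂ, A = Bᴴ * B :=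
  CStarAlgebra.nonneg_iff_eq_star_mul_self.mp hA.nonneg

theorem Matrix.PosSemidef.trace_mul_nonneg {n : Type*} [Fintype n] [DecidableEq n]
    {A X : Matrix n n ℂ} (hA : A.PosSemidef) (hX : X.PosSemidef) : 0 ≤ (A * X).trace := by
  obtain ⟨Y, rfl⟩ := hX.exists_eq_conjTranspose_mul_self
  rw [← Matrix.mul_assoc, Matrix.trace_mul_comm, ← Matrix.mul_assoc]
  exact (hA.mul_mul_conjTranspose_same Y).trace_nonneg

theorem LinearMap.exists_comp_eq_of_ker_le {K V W U : Type*} [Field K] [AddCommGroup V]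
    [Module K V] [AddCommGroup W] [Module K W] [AddCommGroup U] [Module K U]
    (f : V →ₗ[K] W) (g : V →ₗ[K] U) (h : f.ker ≤ g.ker) : ∃ k : W →ₗ[K] U, k ∘ₗ f = g := by
  obtain ⟨k, hk⟩ := LinearMap.exists_extend
    ((f.ker.liftQ g h) ∘ₗ (f.quotKerEquivRange.symm : f.range →ₗ[K] V ⧸ f.ker))
  refine ⟨k, LinearMap.ext fun v => ?_⟩
  have hv : f.quotKerEquivRange.symm ⟨f v, v, rfl⟩ = Submodule.Quotient.mk v :=
    (LinearEquiv.symm_apply_eq _).mpr rfl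
  simpa [hv] using LinearMap.congr_fun hk ⟨f v, v, rfl⟩

open scoped MatrixOrder Matrix.Norms.L2Operator in
theorem Matrix.IsHermitian.exists_posSemidef_smul_one_sub {n : Type*} [Fintype n] [DecidableEq n]
    {K : Matrix n n ℂ} (hK : K.IsHermitian) : ∃ c : ℝ, 0 ≤ c ∧ ((c : ℂ) • 1 - K).PosSemidef := by
  refine ⟨‖K‖, norm_nonneg _, ?_⟩
  have h := IsSelfAdjoint.le_algebraMap_norm_self (a := K) hK
  rw [Matrix.le_iff, Algebra.algebraMap_eq_smul_one] at h
  exact h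

theorem Matrix.PosSemidef.exists_smul_sub_of_ker_le {n : Type*} [Fintype n] [DecidableEq n]
    {ρ σ : Matrix n n ℂ} (hρ : ρ.PosSemidef) (hσ : σ.PosSemidef)
    (h : ∀ v : n → ℂ, σ *ᵥ v = 0 → ρ *ᵥ v = 0) :
    ∃ c : ℝ, 0 ≤ c ∧ ((c : ℂ) • σ - ρ).PosSemidef := by
  obtain ⟨R, rfl⟩ := hρ.exists_eq_conjTranspose_mul_self
  obtain ⟨S, rfl⟩ := hσ.exists_eq_conjTranspose_mul_self
  simp only [conjTranspose_mul_self_mulVec_eq_zero] at h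
  obtain ⟨k, hk⟩ := LinearMap.exists_comp_eq_of_ker_le (toLin' S) (toLin' R) fun v hv => by
    simpa using h v (by simpa using hv)
  have hBS : LinearMap.toMatrix' k * S = R := by
    rw [← LinearMap.toMatrix'_toLin' R, ← hk, LinearMap.toMatrix'_comp, LinearMap.toMatrix'_toLin']
  obtain ⟨c, hc, hpos⟩ := Matrix.IsHermitian.exists_posSemidef_smul_one_sub
    (isHermitian_conjTranspose_mul_self (LinearMap.toMatrix' k))
  refine ⟨c, hc, ?_⟩
  convert hpos.conjTranspose_mul_mul_same S using 1
  rw [← hBS]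
  simp [Matrix.mul_sub, Matrix.sub_mul, Matrix.mul_assoc]

theorem Matrix.PosSemidef.re_trace_mul_le {n : Type*} [Fintype n] [DecidableEq n]
    {ρ σ X : Matrix n n ℂ} {c : ℝ} (h : ((c : ℂ) • σ - ρ).PosSemidef) (hc : 0 ≤ c)
    (hX : X.PosSemidef) (hσX : (σ * X).trace.re ≤ 1) : (ρ * X).trace.re ≤ c := by
  have h0 := (Complex.le_def.mp (h.trace_mul_nonneg hX)).1
  simp [Matrix.sub_mul] at h0
  nlinarith

theorem IsDensity.exists_add_smul_eq_iff {d : ℕ} {ρ σ : Matrix (Fin d) (Fin d) ℂ}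
    (hρ : IsDensity ρ) (hσ : IsDensity σ) {s : ℝ} (hs : 0 ≤ s) :
    (∃ τ, IsDensity τ ∧ ρ + (s : ℂ) • τ = ((1 + s : ℝ) : ℂ) • σ) ↔
      (((1 + s : ℝ) : ℂ) • σ - ρ).PosSemidef := by
  constructor
  · rintro ⟨τ, hτ, h⟩
    rw [← h, add_sub_cancel_left]
    exact hτ.1.smul (by exact_mod_cast hs)
  · intro h
    have htr : (((1 + s : ℝ) : ℂ) • σ - ρ).trace = s := by
      simp [Matrix.trace_sub, Matrix.trace_smul, hρ.2, hσ.2]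
    rcases hs.eq_or_lt with rfl | hs
    · refine ⟨ρ, hρ, ?_⟩
      have := h.trace_eq_zero_iff.mp (by simpa using htr)
      rw [sub_eq_zero.mp this]
      simp
    · have hs' : (s : ℂ) ≠ 0 := by exact_mod_cast hs.ne'
      refine ⟨(s : ℂ)⁻¹ • (((1 + s : ℝ) : ℂ) • σ - ρ), ⟨h.smul ?_, ?_⟩, ?_⟩
      · exact_mod_cast (inv_pos.mpr hs).le
      · rw [Matrix.trace_smul, htr, smul_eq_mul, inv_mul_cancel₀ hs']
      · rw [smul_inv_smul₀ hs', add_sub_cancel]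

/-- The test operators `v v⋆ / ⟨v, σ v⟩` suffice to detect `ρ ≤ c σ`. -/
theorem Matrix.PosSemidef.smul_sub_of_forall_re_trace_mul_le {n : Type*} [Fintype n]
    [DecidableEq n] {ρ σ : Matrix n n ℂ} (hρ : ρ.PosSemidef) (hσ : σ.PosSemidef)
    (h : ∀ v : n → ℂ, σ *ᵥ v = 0 → ρ *ᵥ v = 0) {c : ℝ}
    (hc : ∀ X : Matrix n n ℂ, X.PosSemidef → (σ * X).trace.re ≤ 1 → (ρ * X).trace.re ≤ c) :
    ((c : ℂ) • σ - ρ).PosSemidef := by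
  have hH : ((c : ℂ) • σ - ρ).IsHermitian :=
    (hσ.1.smul (Complex.conj_ofReal c)).sub hρ.1
  refine .of_dotProduct_mulVec_nonneg hH fun v => ?_
  have hvv := posSemidef_vecMulVec_self_star v
  have htr (A : Matrix n n ℂ) : (A * vecMulVec v (star v)).trace = star v ⬝ᵥ A *ᵥ v := by
    rw [mul_vecMulVec, trace_vecMulVec, dotProduct_comm]
  have hρv := Complex.le_def.mp (hρ.dotProduct_mulVec_nonneg v)
  have hσv := Complex.le_def.mp (hσ.dotProduct_mulVec_nonneg v)
  simp only [Complex.zero_re, Complex.zero_im] at hρv hσv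
  have key : (star v ⬝ᵥ ρ *ᵥ v).re ≤ c * (star v ⬝ᵥ σ *ᵥ v).re := by
    rcases hσv.1.eq_or_lt with h0 | hpos
    · have hz : star v ⬝ᵥ σ *ᵥ v = 0 := Complex.ext h0.symm hσv.2.symm
      rw [hz, h v ((hσ.dotProduct_mulVec_zero_iff v).mp hz)]
      simp
    · have := hc ((((star v ⬝ᵥ σ *ᵥ v).re⁻¹ : ℝ) : ℂ) • vecMulVec v (star v))
        (hvv.smul (by exact_mod_cast (inv_pos.mpr hpos).le))
        (by rw [Matrix.mul_smul, Matrix.trace_smul, htr, smul_eq_mul, Complex.re_ofReal_mul,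
              inv_mul_cancel₀ hpos.ne'])
      rwa [Matrix.mul_smul, Matrix.trace_smul, htr, smul_eq_mul, Complex.re_ofReal_mul,
        inv_mul_le_iff₀ hpos, mul_comm] at this
  rw [Matrix.sub_mulVec, Matrix.smul_mulVec, dotProduct_sub, dotProduct_smul, Complex.le_def]
  simp [← hρv.2, ← hσv.2, key]

theorem stmt6 {d : ℕ} (ρ σ : Matrix (Fin d) (Fin d) ℂ)
    (hρ : IsDensity ρ) (hσ : IsDensity σ)
    (hsupp : ∀ v : Fin d → ℂ, σ.mulVec v = 0 → ρ.mulVec v = 0) :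
    sInf {s : ℝ | 0 ≤ s ∧ ∃ τ, IsDensity τ ∧
        ρ + (s : ℂ) • τ = ((1 + s : ℝ) : ℂ) • σ}
      = sSup {r : ℝ | ∃ X : Matrix (Fin d) (Fin d) ℂ, X.PosSemidef ∧
          ((σ * X).trace).re ≤ 1 ∧ r = ((ρ * X).trace).re - 1} := by
  set D := {r : ℝ | ∃ X : Matrix (Fin d) (Fin d) ℂ, X.PosSemidef ∧
    ((σ * X).trace).re ≤ 1 ∧ r = ((ρ * X).trace).re - 1}
  have hbdd : BddAbove D := by
    obtain ⟨c, hc, hpos⟩ := hρ.1.exists_smul_sub_of_ker_le hσ.1 hsupp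
    refine ⟨c - 1, ?_⟩
    rintro r ⟨X, hX, hσX, rfl⟩
    exact sub_le_sub_right (hpos.re_trace_mul_le hc hX hσX) 1
  have hzero : (0 : ℝ) ∈ D := ⟨1, .one, by simp [hσ.2], by simp [hρ.2]⟩
  have hD : 0 ≤ sSup D := le_csSup hbdd hzero
  refine IsLeast.csInf_eq ⟨⟨hD, (hρ.exists_add_smul_eq_iff hσ hD).mpr ?_⟩, ?_⟩
  · refine hρ.1.smul_sub_of_forall_re_trace_mul_le hσ.1 hsupp fun X hX hσX => ?_
    linarith [le_csSup hbdd ⟨X, hX, hσX, rfl⟩]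
  · rintro s ⟨hs, hτ⟩
    refine csSup_le ⟨0, hzero⟩ ?_
    rintro r ⟨X, hX, hσX, rfl⟩
    have := ((hρ.exists_add_smul_eq_iff hσ hs).mp hτ).re_trace_mul_le (by linarith) hX hσX
    linarith
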